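/- arXiv:2202.01632 — 2 statements merged into one kernel-verified Lean document; each statement's English description precedes it below -/
import Mathlib

section
/- For every real λ > 0 and every k ∈ ℕ, the total variation distance between the law of M_k((0,λ]) under μ^ℕ × μ^k and the Poisson distribution with mean λ is at most 5k(λ+1)b^{−k}; in particular it is less than 1/k whenever k ≥ max{24, 2·log₂(λ+1)}. -/
open MeasureTheory Filter

/-- The uniform product measure μ^k on Ω^k, Ω = Fin b: normalized counting measure. -/
noncomputable def muK (b k : ℕ) : Measure (Fin k → Fin b) :=
  ((b : ENNReal) ^ k)⁻¹ • Measure.count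

/-- ν is the product measure μ^ℕ of uniform measures on Ω = Fin b over Ω^ℕ:
every cylinder of length n has measure b^{-n}. -/
def IsUnifProductMeasure (b : ℕ) (ν : Measure (ℕ → Fin b)) : Prop :=
  ∀ (n : ℕ) (w : Fin n → Fin b),
    ν {x | ∀ t : Fin n, x (t : ℕ) = w t} = ((b : ENNReal)⁻¹) ^ n

/-- The word w (of length k) occurs in x at position j (positions numbered from 1):
I_j(x,w) = 1. -/
def OccursAt {b k : ℕ} (x : ℕ → Fin b) (j : ℕ) (w : Fin k → Fin b) : Prop :=
  ∀ t : Fin k, x (j - 1 + (t : ℕ)) = w t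

instance {b k : ℕ} (x : ℕ → Fin b) (j : ℕ) (w : Fin k → Fin b) :
    Decidable (OccursAt x j w) := by unfold OccursAt; infer_instance

/-- M_k^x(S)(w) = Σ_{j ∈ ℕ ∩ b^k S} I_j(x,w): the number of positive integers j with
j/b^k ∈ S at which w occurs in x. -/
noncomputable def Mx (b k : ℕ) (S : Set ℝ) (x : ℕ → Fin b) (w : Fin k → Fin b) : ℕ :=
  {j : ℕ | 1 ≤ j ∧ ((j : ℝ) / (b : ℝ) ^ k) ∈ S ∧ OccursAt x j w}.ncard

/-- Z^λ_{i,k}(x): proportion of words of length k occurring exactly i times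
among positions 1 ≤ j ≤ λ b^k of x. -/
noncomputable def Z (b k i : ℕ) (lam : ℝ) (x : ℕ → Fin b) : ℝ :=
  ((Finset.univ.filter (fun w : Fin k → Fin b =>
      ((Finset.Icc 1 ⌊lam * (b : ℝ) ^ k⌋₊).filter (fun j => OccursAt x j w)).card = i)).card : ℝ)
    / (b : ℝ) ^ k

/-- x is λ-Poisson generic. -/
def LamPoissonGeneric (b : ℕ) (lam : ℝ) (x : ℕ → Fin b) : Prop :=
  ∀ i : ℕ, Tendsto (fun k : ℕ => Z b k i lam x) atTop
    (nhds (Real.exp (-lam) * lam ^ i / (Nat.factorial i : ℝ)))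

/-- x is Poisson generic. -/
def PoissonGeneric (b : ℕ) (x : ℕ → Fin b) : Prop :=
  ∀ lam : ℝ, 0 < lam → LamPoissonGeneric b lam x

/-- S ⊆ [0,∞) is a finite union of pairwise disjoint intervals with rational endpoints. -/
def IsFinRatIntervalUnion (S : Set ℝ) : Prop :=
  ∃ (n : ℕ) (p q : Fin n → ℚ), (∀ m, 0 ≤ p m) ∧
    (Pairwise fun m l : Fin n =>
      Disjoint (Set.Ioo ((p m : ℝ)) ((q m : ℝ))) (Set.Ioo ((p l : ℝ)) ((q l : ℝ)))) ∧
    S = ⋃ m, Set.Ioo ((p m : ℝ)) ((q m : ℝ))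

/-- Total variation distance between two laws on ℕ (given as set functions). -/
noncomputable def dTV (P Q : Set ℕ → ℝ) : ℝ := ⨆ A : Set ℕ, |P A - Q A|

/-- The law on ℕ of M_k(S) under μ^ℕ × μ^k. -/
noncomputable def lawM (b k : ℕ) (ν : Measure (ℕ → Fin b)) (S : Set ℝ) (A : Set ℕ) : ℝ :=
  ((ν.prod (muK b k)) {p : (ℕ → Fin b) × (Fin k → Fin b) | Mx b k S p.1 p.2 ∈ A}).toReal

/-- The law on ℕ of M_k^x(S) under μ^k. -/
noncomputable def lawMx (b k : ℕ) (x : ℕ → Fin b) (S : Set ℝ) (A : Set ℕ) : ℝ :=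
  ((muK b k) {w : Fin k → Fin b | Mx b k S x w ∈ A}).toReal

/-- The Poisson law with mean λ, as a set function on ℕ. -/
noncomputable def poissonLaw (lam : ℝ) (A : Set ℕ) : ℝ :=
  ∑' i : A, Real.exp (-lam) * lam ^ (i : ℕ) / (Nat.factorial (i : ℕ) : ℝ)

/-- The weight `e^{-λ} λ^i / i!` of the Poisson distribution. -/
noncomputable def poissonWeight (lam : ℝ) (i : ℕ) : ℝ :=
  Real.exp (-lam) * lam ^ i / (Nat.factorial i : ℝ)

section SteinEquation

variable {lam : ℝ}

lemma poissonWeight_pos (hlam : 0 < lam) (i : ℕ) : 0 < poissonWeight lam i := by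
  unfold poissonWeight; positivity

lemma poissonWeight_succ (lam : ℝ) (i : ℕ) :
    ((i : ℝ) + 1) * poissonWeight lam (i + 1) = lam * poissonWeight lam i := by
  unfold poissonWeight
  rw [Nat.factorial_succ, pow_succ]
  push_cast
  field_simp

lemma hasSum_poissonWeight (lam : ℝ) : HasSum (poissonWeight lam) 1 := by
  have h := (NormedSpace.expSeries_div_hasSum_exp (𝔸 := ℝ) lam).mul_left (Real.exp (-lam))
  rw [← Real.exp_eq_exp_ℝ, ← Real.exp_add, neg_add_cancel, Real.exp_zero] at h
  simp only [← mul_div_assoc] at h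
  exact h

/-- Poisson weights are log-concave. -/
lemma poissonWeight_mul_le (hlam : 0 < lam) {i m : ℕ} (h : i ≤ m) :
    poissonWeight lam i * poissonWeight lam (m + 1)
      ≤ poissonWeight lam (i + 1) * poissonWeight lam m := by
  have hi := poissonWeight_succ lam i
  have hm := poissonWeight_succ lam m
  have e1 : poissonWeight lam (i + 1) = lam * poissonWeight lam i / (i + 1) := by
    rw [← hi]; field_simp
  have e2 : poissonWeight lam (m + 1) = lam * poissonWeight lam m / (m + 1) := by
    rw [← hm]; field_simp
  have p1 := poissonWeight_pos hlam i
  have p2 := poissonWeight_pos hlam m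
  have him : (i : ℝ) ≤ m := by exact_mod_cast h
  calc poissonWeight lam i * poissonWeight lam (m + 1)
      = lam * poissonWeight lam i * poissonWeight lam m / (m + 1) := by rw [e2]; ring
    _ ≤ lam * poissonWeight lam i * poissonWeight lam m / (i + 1) := by gcongr
    _ = _ := by rw [e1]; ring

/-- The distribution function of the Poisson distribution. -/
noncomputable def poissonCdf (lam : ℝ) (m : ℕ) : ℝ :=
  ∑ i ∈ Finset.range (m + 1), poissonWeight lam i

lemma poissonCdf_succ (lam : ℝ) (m : ℕ) :
    poissonCdf lam (m + 1) = poissonCdf lam m + poissonWeight lam (m + 1) :=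
  Finset.sum_range_succ _ _

lemma hasSum_poissonWeight_tail (lam : ℝ) (m : ℕ) :
    HasSum (fun i => poissonWeight lam (i + (m + 1))) (1 - poissonCdf lam m) :=
  (hasSum_nat_add_iff' (m + 1)).2 (hasSum_poissonWeight lam)

lemma poissonCdf_div_mono (hlam : 0 < lam) (m : ℕ) :
    poissonCdf lam m / poissonWeight lam m
      ≤ poissonCdf lam (m + 1) / poissonWeight lam (m + 1) := by
  rw [div_le_div_iff₀ (poissonWeight_pos hlam _) (poissonWeight_pos hlam _)]
  have h : poissonCdf lam m * poissonWeight lam (m + 1)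
      ≤ (∑ i ∈ Finset.range (m + 1), poissonWeight lam (i + 1)) * poissonWeight lam m := by
    unfold poissonCdf
    rw [Finset.sum_mul, Finset.sum_mul]
    refine Finset.sum_le_sum fun i hi => poissonWeight_mul_le hlam ?_
    have := Finset.mem_range.1 hi
    omega
  refine h.trans (mul_le_mul_of_nonneg_right ?_ (poissonWeight_pos hlam _).le)
  rw [poissonCdf, Finset.sum_range_succ' _ (m + 1)]
  linarith [poissonWeight_pos hlam 0]

lemma poissonTail_div_anti (hlam : 0 < lam) (m : ℕ) :
    (1 - poissonCdf lam (m + 1)) / poissonWeight lam (m + 1)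
      ≤ (1 - poissonCdf lam m) / poissonWeight lam m := by
  rw [div_le_div_iff₀ (poissonWeight_pos hlam _) (poissonWeight_pos hlam _)]
  refine hasSum_le (fun i => ?_) ((hasSum_poissonWeight_tail lam (m + 1)).mul_right _)
    ((hasSum_poissonWeight_tail lam m).mul_right _)
  have := poissonWeight_mul_le hlam (show m ≤ i + (m + 1) by omega)
  rw [show i + (m + 1 + 1) = i + (m + 1) + 1 by ring]
  linarith

/-- The Poisson mass of `A ∩ [0, m]`. -/
noncomputable def poissonPartial (lam : ℝ) (A : Set ℕ) (m : ℕ) : ℝ :=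
  ∑ i ∈ Finset.range (m + 1), A.indicator (poissonWeight lam) i

lemma poissonPartial_succ (lam : ℝ) (A : Set ℕ) (m : ℕ) :
    poissonPartial lam A (m + 1)
      = poissonPartial lam A m + A.indicator (poissonWeight lam) (m + 1) :=
  Finset.sum_range_succ _ _

lemma hasSum_poissonLaw (lam : ℝ) (A : Set ℕ) :
    HasSum (A.indicator (poissonWeight lam)) (poissonLaw lam A) := by
  have h := ((hasSum_poissonWeight lam).summable.indicator A).hasSum
  rwa [← tsum_subtype] at h

lemma indicator_poissonWeight_nonneg (hlam : 0 < lam) (A : Set ℕ) (i : ℕ) :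
    0 ≤ A.indicator (poissonWeight lam) i :=
  Set.indicator_nonneg (fun j _ => (poissonWeight_pos hlam j).le) i

lemma poissonPartial_nonneg (hlam : 0 < lam) (A : Set ℕ) (m : ℕ) :
    0 ≤ poissonPartial lam A m :=
  Finset.sum_nonneg fun i _ => indicator_poissonWeight_nonneg hlam A i

lemma poissonPartial_le_poissonLaw (hlam : 0 < lam) (A : Set ℕ) (m : ℕ) :
    poissonPartial lam A m ≤ poissonLaw lam A :=
  sum_le_hasSum _ (fun i _ => indicator_poissonWeight_nonneg hlam A i) (hasSum_poissonLaw lam A)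

lemma poissonLaw_compl (lam : ℝ) (A : Set ℕ) :
    poissonLaw lam Aᶜ = 1 - poissonLaw lam A := by
  have h := (hasSum_poissonLaw lam A).add (hasSum_poissonLaw lam Aᶜ)
  have e : (fun i => A.indicator (poissonWeight lam) i + Aᶜ.indicator (poissonWeight lam) i)
      = poissonWeight lam :=
    funext fun i => congrFun (Set.indicator_self_add_compl A (poissonWeight lam)) i
  rw [e] at h
  linarith [h.unique (hasSum_poissonWeight lam)]

lemma poissonPartial_compl (lam : ℝ) (A : Set ℕ) (m : ℕ) :
    poissonPartial lam Aᶜ m = poissonCdf lam m - poissonPartial lam A m := by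
  unfold poissonPartial poissonCdf
  rw [eq_sub_iff_add_eq', ← Finset.sum_add_distrib]
  exact Finset.sum_congr rfl fun i _ => congrFun (Set.indicator_self_add_compl A _) i

/-- The solution, shifted by one, of the Stein equation for the Poisson distribution and the
indicator function of `A`. -/
noncomputable def steinSol (lam : ℝ) (A : Set ℕ) (m : ℕ) : ℝ :=
  (poissonPartial lam A m - poissonLaw lam A * poissonCdf lam m) / (lam * poissonWeight lam m)

lemma steinSol_compl (lam : ℝ) (A : Set ℕ) (m : ℕ) :
    steinSol lam Aᶜ m = -steinSol lam A m := by
  unfold steinSol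
  rw [poissonPartial_compl, poissonLaw_compl]
  ring

lemma lam_mul_steinSol_zero (hlam : 0 < lam) (A : Set ℕ) :
    lam * steinSol lam A 0 = A.indicator 1 0 - poissonLaw lam A := by
  have h0 := poissonWeight_pos hlam 0
  have e : A.indicator (poissonWeight lam) 0 = A.indicator 1 0 * poissonWeight lam 0 := by
    by_cases h : 0 ∈ A <;> simp [h]
  simp only [steinSol, poissonPartial, poissonCdf, zero_add, Finset.sum_range_one, e]
  field_simp

lemma lam_mul_steinSol_succ (hlam : 0 < lam) (A : Set ℕ) (m : ℕ) :
    lam * steinSol lam A (m + 1) - ((m : ℝ) + 1) * steinSol lam A m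
      = A.indicator 1 (m + 1) - poissonLaw lam A := by
  have h0 := poissonWeight_pos hlam m
  have h1 := poissonWeight_pos hlam (m + 1)
  have e : A.indicator (poissonWeight lam) (m + 1)
      = A.indicator 1 (m + 1) * poissonWeight lam (m + 1) := by
    by_cases h : m + 1 ∈ A <;> simp [h]
  have : (0 : ℝ) < (m : ℝ) + 1 := by positivity
  rw [steinSol, steinSol, poissonPartial_succ, poissonCdf_succ, e, ← poissonWeight_succ lam m]
  field_simp
  ring

lemma steinSol_sub_le (hlam : 0 < lam) (A : Set ℕ) (m : ℕ) :
    steinSol lam A (m + 1) - steinSol lam A m ≤ 1 / lam := by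
  have hU := poissonCdf_div_mono hlam m
  have hV := poissonTail_div_anti hlam m
  have ha := poissonPartial_nonneg hlam A m
  have hc := sub_nonneg.2 (poissonPartial_le_poissonLaw hlam A m)
  have h0 := poissonWeight_pos hlam m
  have h1 := poissonWeight_pos hlam (m + 1)
  have he : A.indicator (poissonWeight lam) (m + 1) ≤ poissonWeight lam (m + 1) :=
    Set.indicator_le_self' (fun _ _ => h1.le) _
  rw [steinSol, steinSol, poissonPartial_succ, mul_comm lam, mul_comm lam, ← div_div,
    ← div_div, ← sub_div]
  gcongr
  have key : (poissonPartial lam A m + A.indicator (poissonWeight lam) (m + 1)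
        - poissonLaw lam A * poissonCdf lam (m + 1)) / poissonWeight lam (m + 1)
      - (poissonPartial lam A m - poissonLaw lam A * poissonCdf lam m) / poissonWeight lam m
      = poissonPartial lam A m * ((1 - poissonCdf lam (m + 1)) / poissonWeight lam (m + 1)
          - (1 - poissonCdf lam m) / poissonWeight lam m)
        - (poissonLaw lam A - poissonPartial lam A m)
          * (poissonCdf lam (m + 1) / poissonWeight lam (m + 1)
            - poissonCdf lam m / poissonWeight lam m)
        + A.indicator (poissonWeight lam) (m + 1) / poissonWeight lam (m + 1) := by
    field_simp
    ring
  rw [key]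
  have t1 := mul_nonneg ha (sub_nonneg.2 hV)
  have t2 := mul_nonneg hc (sub_nonneg.2 hU)
  have t3 := (div_le_one h1).2 he
  linarith

lemma abs_steinSol_sub_le (hlam : 0 < lam) (A : Set ℕ) (m : ℕ) :
    |steinSol lam A (m + 1) - steinSol lam A m| ≤ 1 / lam := by
  have h := steinSol_sub_le hlam Aᶜ m
  rw [steinSol_compl, steinSol_compl] at h
  exact abs_le.2 ⟨by linarith, steinSol_sub_le hlam A m⟩

lemma poissonLaw_nonneg (hlam : 0 < lam) (A : Set ℕ) : 0 ≤ poissonLaw lam A :=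
  (hasSum_poissonLaw lam A).nonneg (indicator_poissonWeight_nonneg hlam A)

lemma abs_indicator_sub_poissonLaw_le (hlam : 0 < lam) (A : Set ℕ) (m : ℕ) :
    |A.indicator 1 m - poissonLaw lam A| ≤ 1 := by
  have h1 := poissonLaw_nonneg hlam A
  have h2 := poissonLaw_nonneg hlam Aᶜ
  rw [poissonLaw_compl] at h2
  rw [abs_le]
  by_cases h : m ∈ A <;> simp [h] <;> constructor <;> linarith

lemma abs_steinSol_zero_le (hlam : 0 < lam) (A : Set ℕ) : |steinSol lam A 0| ≤ 1 := by
  have main : ∀ B : Set ℕ, 0 ∈ B → |lam * steinSol lam B 0| ≤ lam := by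
    intro B hB
    have h1 := poissonPartial_le_poissonLaw hlam B 0
    have h2 := poissonLaw_nonneg hlam Bᶜ
    rw [poissonLaw_compl] at h2
    have h3 : poissonPartial lam B 0 = Real.exp (-lam) := by
      simp [poissonPartial, hB, poissonWeight]
    have h4 := Real.add_one_le_exp (-lam)
    rw [lam_mul_steinSol_zero hlam, Set.indicator_of_mem hB, Pi.one_apply, abs_of_nonneg h2]
    linarith
  have h : |lam * steinSol lam A 0| ≤ lam := by
    by_cases hA : 0 ∈ A
    · exact main A hA
    · have := main Aᶜ hA
      rwa [steinSol_compl, mul_neg, abs_neg] at this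
  rw [abs_mul, abs_of_pos hlam] at h
  nlinarith

lemma abs_steinSol_le_div (hlam : 0 < lam) (A : Set ℕ) (m : ℕ) :
    |lam - ((m : ℝ) + 1)| * |steinSol lam A m| ≤ 2 := by
  have h1 := abs_indicator_sub_poissonLaw_le hlam A (m + 1)
  rw [← lam_mul_steinSol_succ hlam] at h1
  have h2 := mul_le_mul_of_nonneg_left (abs_steinSol_sub_le hlam A m) hlam.le
  rw [mul_one_div_cancel hlam.ne'] at h2
  nth_rewrite 1 [← abs_of_pos hlam] at h2
  rw [← abs_mul] at h2
  rw [← abs_mul]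
  rw [abs_le] at *
  constructor <;> nlinarith

lemma abs_steinSol_le (hlam : 0 < lam) (A : Set ℕ) (m : ℕ) :
    |steinSol lam A m| ≤ 4 + 5 * lam := by
  have hm := abs_steinSol_le_div hlam A m
  have hn := abs_nonneg (steinSol lam A m)
  rcases lt_or_ge lam 1 with h1 | h1
  · rcases m with _ | m
    · linarith [abs_steinSol_zero_le hlam A]
    · have : (1 : ℝ) ≤ |lam - (((m + 1 : ℕ) : ℝ) + 1)| := by
        rw [abs_of_nonpos] <;> push_cast <;> nlinarith [(Nat.cast_nonneg m : (0 : ℝ) ≤ m)]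
      nlinarith
  · have hd : 1 / lam ≤ 1 := by rw [div_le_one hlam]; exact h1
    rcases le_or_gt (1 / 2) |lam - ((m : ℝ) + 1)| with h2 | h2
    · nlinarith
    · have h3 := abs_steinSol_le_div hlam A (m + 1)
      have h4 : 1 / 2 ≤ |lam - (((m + 1 : ℕ) : ℝ) + 1)| := by
        rw [abs_lt] at h2
        rw [abs_of_nonpos] <;> push_cast <;> linarith
      have h5 := abs_steinSol_sub_le hlam A m
      have h6 := abs_sub_abs_le_abs_sub (steinSol lam A m) (steinSol lam A (m + 1))
      rw [abs_sub_comm] at h6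
      have h7 := abs_nonneg (steinSol lam A (m + 1))
      nlinarith

end SteinEquation

open Finset in
/-- A finite Chen–Stein estimate for sums of pairwise independent indicators, each of which is
independent of the sum of the indicators outside its dependency neighbourhood. -/
lemma chenStein_finite {G ι : Type*} [Fintype G] [Fintype ι] [DecidableEq ι]
    (X : ι → G → ℕ) (hX : ∀ i g, X i g = 0 ∨ X i g = 1) (B : ι → Finset ι)
    (hB : ∀ i, i ∈ B i) {D : ℕ} (hD : ∀ i, #(B i) ≤ D) {p L : ℝ} (hp : 0 ≤ p)
    (hind : ∀ i (F : ℕ → ℝ), ∑ g, (X i g : ℝ) * F (∑ j ∈ (B i)ᶜ, X j g)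
      = p * ∑ g, F (∑ j ∈ (B i)ᶜ, X j g))
    (hpair : ∀ i j, i ≠ j → ∑ g, (X i g : ℝ) * X j g = p ^ 2 * Fintype.card G)
    (f : ℕ → ℝ) (hf : ∀ m, |f (m + 1) - f m| ≤ L) :
    |∑ g, (Fintype.card ι * p * f (∑ j, X j g)
        - ((∑ j, X j g : ℕ) : ℝ) * f (∑ j, X j g - 1))|
      ≤ L * (Fintype.card G * (Fintype.card ι * (p ^ 2 * (2 * D - 1)))) := by
  have hL : 0 ≤ L := (abs_nonneg _).trans (hf 0)
  have hlip : ∀ m r : ℕ, |f (m + r) - f m| ≤ L * r := by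
    intro m r
    induction r with
    | zero => simp
    | succ r ih =>
      have h1 := abs_sub_le (f (m + (r + 1))) (f (m + r)) (f m)
      have h2 := hf (m + r)
      rw [add_assoc] at h2
      push_cast
      linarith
  have hsplit : ∀ i g, ∑ j, X j g = ∑ j ∈ (B i)ᶜ, X j g + ∑ j ∈ B i, X j g := fun i g =>
    (sum_compl_add_sum (B i) _).symm
  have hmean : ∀ i, ∑ g, (X i g : ℝ) = p * Fintype.card G := by
    intro i
    simpa using hind i fun _ => 1
  have hterm : ∀ i, |∑ g, (p * f (∑ j, X j g) - (X i g : ℝ) * f (∑ j, X j g - 1))|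
      ≤ L * (Fintype.card G * (p ^ 2 * (2 * D - 1))) := by
    intro i
    have hsub : ∑ g, (p * f (∑ j, X j g) - (X i g : ℝ) * f (∑ j, X j g - 1))
        = ∑ g, (p * (f (∑ j, X j g) - f (∑ j ∈ (B i)ᶜ, X j g))
          + (X i g : ℝ) * (f (∑ j ∈ (B i)ᶜ, X j g) - f (∑ j, X j g - 1))) := by
      have := hind i f
      simp only [mul_sub, sum_add_distrib, sum_sub_distrib, ← mul_sum]
      linarith
    have hfar : ∀ g, |p * (f (∑ j, X j g) - f (∑ j ∈ (B i)ᶜ, X j g))|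
        ≤ L * (p * ∑ j ∈ B i, (X j g : ℝ)) := by
      intro g
      rw [abs_mul, abs_of_nonneg hp, hsplit i g]
      have := mul_le_mul_of_nonneg_left (hlip (∑ j ∈ (B i)ᶜ, X j g) (∑ j ∈ B i, X j g)) hp
      push_cast at this
      linarith
    have hnear : ∀ g, |(X i g : ℝ) * (f (∑ j ∈ (B i)ᶜ, X j g) - f (∑ j, X j g - 1))|
        ≤ L * ∑ j ∈ (B i).erase i, (X i g : ℝ) * X j g := by
      intro g
      rcases hX i g with h | h
      · simp [h]
      · have e : ∑ j, X j g - 1 = ∑ j ∈ (B i)ᶜ, X j g + ∑ j ∈ (B i).erase i, X j g := by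
          rw [hsplit i g, ← add_sum_erase (B i) _ (hB i), h]
          omega
        rw [e, h, abs_mul, abs_sub_comm]
        simpa using hlip (∑ j ∈ (B i)ᶜ, X j g) (∑ j ∈ (B i).erase i, X j g)
    have hDi : (#(B i) : ℝ) ≤ D := by exact_mod_cast hD i
    have hDe : (#((B i).erase i) : ℝ) ≤ D - 1 := by
      rw [← card_erase_add_one (hB i)] at hDi
      push_cast at hDi
      linarith
    have hsum_far : ∑ g, ∑ j ∈ B i, (X j g : ℝ) = #(B i) * (p * Fintype.card G) := by
      rw [sum_comm, sum_congr rfl fun j _ => hmean j, sum_const, nsmul_eq_mul]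
    have hsum_near : ∑ g, ∑ j ∈ (B i).erase i, (X i g : ℝ) * X j g
        = #((B i).erase i) * (p ^ 2 * Fintype.card G) := by
      rw [sum_comm, sum_congr rfl fun j hj => hpair i j (ne_of_mem_erase hj).symm, sum_const,
        nsmul_eq_mul]
    rw [hsub]
    calc _ ≤ ∑ g, (L * (p * ∑ j ∈ B i, (X j g : ℝ))
            + L * ∑ j ∈ (B i).erase i, (X i g : ℝ) * X j g) :=
          (abs_sum_le_sum_abs _ _).trans (sum_le_sum fun g _ =>
            (abs_add_le _ _).trans (add_le_add (hfar g) (hnear g)))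
      _ = L * (Fintype.card G * (p ^ 2 * (#(B i) + #((B i).erase i)))) := by
          rw [sum_add_distrib, ← mul_sum, ← mul_sum, ← mul_sum, hsum_far, hsum_near]
          ring
      _ ≤ _ := by gcongr; linarith
  have hdecomp : ∑ g, (Fintype.card ι * p * f (∑ j, X j g)
        - ((∑ j, X j g : ℕ) : ℝ) * f (∑ j, X j g - 1))
      = ∑ i, ∑ g, (p * f (∑ j, X j g) - (X i g : ℝ) * f (∑ j, X j g - 1)) := by
    rw [sum_comm]
    refine sum_congr rfl fun g _ => ?_
    rw [sum_sub_distrib, sum_const, ← sum_mul, card_univ, nsmul_eq_mul]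
    push_cast
    ring
  rw [hdecomp]
  calc _ ≤ ∑ _i : ι, L * (Fintype.card G * (p ^ 2 * (2 * D - 1))) :=
        (abs_sum_le_sum_abs _ _).trans (sum_le_sum fun i _ => hterm i)
    _ = _ := by rw [sum_const, card_univ, nsmul_eq_mul]; ring

/-- If `F` is invariant under translations whose images exhaust `H`, then the average of `F` over
the kernel of `φ` is its average over the whole group. -/
lemma card_mul_sum_ker {G H : Type*} [AddCommGroup G] [Fintype G] [AddCommGroup H] [Fintype H]
    [DecidableEq H] (φ : G →+ H) (F : G → ℝ)
    (hF : ∀ c, ∃ t, φ t = c ∧ ∀ g, F (g + t) = F g) :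
    Fintype.card H * ∑ g, (if φ g = 0 then F g else 0) = ∑ g, F g := by
  have h : ∀ c, ∑ g, (if φ g = c then F g else 0) = ∑ g, (if φ g = 0 then F g else 0) := by
    intro c
    obtain ⟨t, ht, hFt⟩ := hF c
    rw [← Equiv.sum_comp (Equiv.addRight t)]
    refine Finset.sum_congr rfl fun g _ => ?_
    simp [hFt, ht]
  calc _ = ∑ c, ∑ g, (if φ g = c then F g else 0) := by simp [h]
    _ = ∑ g, F g := by rw [Finset.sum_comm]; simp

section Words

variable {R : Type*} [AddCommGroup R] {n k : ℕ}

/-- The difference between the block of length `k` at position `j` of the first component and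
the second component. -/
def blockSub (j : Fin n) : (Fin (n + k) → R) × (Fin k → R) →+ (Fin k → R) where
  toFun g t := g.1 ⟨j + t, by omega⟩ - g.2 t
  map_zero' := by ext; simp
  map_add' g h := by ext; simp; abel

lemma blockSub_apply (j : Fin n) (g : (Fin (n + k) → R) × (Fin k → R)) (t : Fin k) :
    blockSub j g t = g.1 ⟨j + t, by omega⟩ - g.2 t := rfl

lemma exists_blockSub_eq_and_far_zero (i : Fin n) (c : Fin k → R) :
    ∃ g : (Fin (n + k) → R) × (Fin k → R), blockSub i g = c ∧
      ∀ j : Fin n, (j + k ≤ (i : ℕ) ∨ i + k ≤ (j : ℕ)) → blockSub j g = 0 := by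
  refine ⟨(fun s => if h : (i : ℕ) ≤ s ∧ (s : ℕ) - i < k then c ⟨s - i, h.2⟩ else 0, 0), ?_, ?_⟩
  · ext t
    simp [blockSub_apply]
  · intro j hj
    ext t
    have : ¬ ((i : ℕ) ≤ j + t ∧ (j : ℕ) + t - i < k) := by omega
    simp [blockSub_apply, this]

lemma exists_shift_sub_eq {d : ℕ} (hd : 0 < d) (c : ℕ → R) :
    ∃ y : ℕ → R, ∀ s, y (s + d) - y s = c s := by
  refine ⟨fun s => ∑ r ∈ Finset.range (s / d), c (s % d + d * r), fun s => ?_⟩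
  simp [Nat.add_div_right _ hd, Finset.sum_range_succ, Nat.mod_add_div]

lemma exists_blockSub_pair_of_lt {i j : Fin n} (hij : i < j) (u v : Fin k → R) :
    ∃ g : (Fin (n + k) → R) × (Fin k → R), blockSub i g = u ∧ blockSub j g = v := by
  have hij' : (i : ℕ) < j := hij
  obtain ⟨y, hy⟩ := exists_shift_sub_eq (Nat.sub_pos_of_lt hij')
    (fun s => if h : s - i < k then v ⟨s - i, h⟩ - u ⟨s - i, h⟩ else 0)
  refine ⟨(fun s => y s, fun t => y (i + t) - u t), ?_, ?_⟩
  · ext t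
    simp [blockSub_apply]
  · ext t
    have h := hy (i + t)
    rw [show (i : ℕ) + t + (j - i) = j + t by omega] at h
    simp only [add_tsub_cancel_left, Fin.is_lt, dite_true, Fin.eta] at h
    rw [blockSub_apply, sub_sub_eq_add_sub, add_sub_right_comm, h]
    abel

lemma exists_blockSub_pair {i j : Fin n} (hij : i ≠ j) (u v : Fin k → R) :
    ∃ g : (Fin (n + k) → R) × (Fin k → R), blockSub i g = u ∧ blockSub j g = v := by
  rcases lt_or_gt_of_ne hij with h | h
  · exact exists_blockSub_pair_of_lt h u v
  · obtain ⟨g, h1, h2⟩ := exists_blockSub_pair_of_lt h v u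
    exact ⟨g, h2, h1⟩

variable [Fintype R] [DecidableEq R]

/-- The number of positions at which the word `g.2` occurs in `g.1`. -/
def occurrences (g : (Fin (n + k) → R) × (Fin k → R)) : ℕ :=
  ∑ j : Fin n, if blockSub j g = 0 then 1 else 0

/-- The positions whose blocks of length `k` overlap the block at position `i`. -/
def overlapping (k : ℕ) (i : Fin n) : Finset (Fin n) :=
  Finset.univ.filter fun j => (i : ℕ) < j + k ∧ (j : ℕ) < i + k

lemma card_overlapping_le (i : Fin n) : (overlapping k i).card ≤ 2 * k - 1 := by
  have h : ((overlapping k i).image fun j : Fin n => ((j : ℕ) : ℤ))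
      ⊆ Finset.Ioo ((i : ℤ) - k) (i + k) := by
    intro z hz
    simp only [overlapping, Finset.mem_image, Finset.mem_filter, Finset.mem_univ, true_and] at hz
    obtain ⟨j, hj, rfl⟩ := hz
    rw [Finset.mem_Ioo]
    omega
  have h2 := Finset.card_le_card h
  rw [Finset.card_image_of_injective _ (fun a b hab => Fin.ext (by exact_mod_cast hab)),
    Int.card_Ioo] at h2
  omega

lemma abs_sum_stein_occurrences_le (hk : 1 ≤ k) {L : ℝ} (f : ℕ → ℝ)
    (hf : ∀ m, |f (m + 1) - f m| ≤ L) :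
    |∑ g : (Fin (n + k) → R) × (Fin k → R),
        (n * ((Fintype.card R : ℝ) ^ k)⁻¹ * f (occurrences g)
          - (occurrences g : ℝ) * f (occurrences g - 1))|
      ≤ L * (Fintype.card ((Fin (n + k) → R) × (Fin k → R))
          * (n * ((((Fintype.card R : ℝ) ^ k)⁻¹) ^ 2 * (4 * k - 3)))) := by
  have hR : (0 : ℝ) < Fintype.card R := by exact_mod_cast Fintype.card_pos
  have h := chenStein_finite (G := (Fin (n + k) → R) × (Fin k → R))
    (fun j g => if blockSub j g = 0 then 1 else 0) (fun i g => by split_ifs <;> simp)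
    (overlapping k) (fun i => by simp [overlapping]; omega) card_overlapping_le
    (p := ((Fintype.card R : ℝ) ^ k)⁻¹) (by positivity) ?_ ?_ f hf
  · rw [Fintype.card_fin, Nat.cast_sub (by omega)] at h
    refine h.trans_eq ?_
    push_cast
    ring
  · intro i F
    rw [eq_inv_mul_iff_mul_eq₀ (by positivity), ← card_mul_sum_ker (blockSub i) fun g =>
      F (∑ j ∈ (overlapping k i)ᶜ, if blockSub j g = 0 then 1 else 0)]
    · simp
    · intro c
      obtain ⟨t, ht, hfar⟩ := exists_blockSub_eq_and_far_zero i c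
      refine ⟨t, ht, fun g => ?_⟩
      congr 1
      refine Finset.sum_congr rfl fun j hj => ?_
      rw [map_add, hfar j, add_zero]
      simp [overlapping] at hj
      omega
  · intro i j hij
    rw [inv_pow, eq_inv_mul_iff_mul_eq₀ (by positivity)]
    have h := card_mul_sum_ker ((blockSub i).prod (blockSub j)) (fun _ => 1)
      fun c : (Fin k → R) × (Fin k → R) => by
        obtain ⟨g, h1, h2⟩ := exists_blockSub_pair (k := k) hij c.1 c.2
        exact ⟨g, Prod.ext h1 h2, fun _ => rfl⟩
    simp only [Finset.sum_const, Finset.card_univ, nsmul_eq_mul, mul_one] at h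
    rw [← h]
    simp only [AddMonoidHom.prod_apply, Prod.mk_eq_zero, and_comm (a := blockSub i _ = 0)]
    simp [ite_and, sq]

/-- Poisson approximation for the proportion of pairs whose number of occurrences lies in `A`. -/
lemma abs_card_occurrences_sub_poissonLaw_le (hk : 1 ≤ k) {lam : ℝ} (hlam : 0 < lam)
    (hn : n = ⌊lam * (Fintype.card R : ℝ) ^ k⌋₊) (A : Set ℕ) :
    |(∑ g : (Fin (n + k) → R) × (Fin k → R), A.indicator 1 (occurrences g))
        / (Fintype.card ((Fin (n + k) → R) × (Fin k → R)) : ℝ) - poissonLaw lam A|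
      ≤ 5 * k * (lam + 1) / (Fintype.card R : ℝ) ^ k := by
  have hR : (0 : ℝ) < (Fintype.card R : ℝ) ^ k := by
    have : (0 : ℝ) < Fintype.card R := by exact_mod_cast Fintype.card_pos
    positivity
  set q := (Fintype.card R : ℝ) ^ k with hq
  set c := (Fintype.card ((Fin (n + k) → R) × (Fin k → R)) : ℝ) with hc
  have hcpos : 0 < c := by rw [hc]; exact_mod_cast Fintype.card_pos
  have hn1 : (n : ℝ) ≤ lam * q := hn ▸ Nat.floor_le (by positivity)
  have hn2 : lam * q < n + 1 := hn ▸ Nat.lt_floor_add_one _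
  have hk' : (1 : ℝ) ≤ k := by exact_mod_cast hk
  have hstein : ∀ m : ℕ, lam * steinSol lam A m - (m : ℝ) * steinSol lam A (m - 1)
      = A.indicator 1 m - poissonLaw lam A := by
    rintro (_ | m)
    · simpa using lam_mul_steinSol_zero hlam A
    · simpa using lam_mul_steinSol_succ hlam A m
  have hchen := abs_sum_stein_occurrences_le (R := R) (n := n) hk (steinSol lam A)
    (abs_steinSol_sub_le hlam A)
  rw [← hq, ← hc] at hchen
  have hmass : |∑ g : (Fin (n + k) → R) × (Fin k → R),
      (lam - n * q⁻¹) * steinSol lam A (occurrences g)| ≤ c * (q⁻¹ * (4 + 5 * lam)) := by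
    refine (Finset.abs_sum_le_sum_abs _ _).trans ?_
    rw [hc, ← Finset.card_univ, ← nsmul_eq_mul (Finset.card _), ← Finset.sum_const]
    refine Finset.sum_le_sum fun g _ => ?_
    rw [abs_mul]
    refine mul_le_mul ?_ (abs_steinSol_le hlam A _) (abs_nonneg _) (by positivity)
    have e : lam - n * q⁻¹ = (lam * q - n) * q⁻¹ := by field_simp
    rw [e, abs_of_nonneg (mul_nonneg (by linarith) (by positivity))]
    exact mul_le_of_le_one_left (by positivity) (by linarith)
  have hsum : (∑ g : (Fin (n + k) → R) × (Fin k → R), A.indicator 1 (occurrences g)) / c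
        - poissonLaw lam A
      = (∑ g : (Fin (n + k) → R) × (Fin k → R),
          (n * q⁻¹ * steinSol lam A (occurrences g)
            - (occurrences g : ℝ) * steinSol lam A (occurrences g - 1))
        + ∑ g : (Fin (n + k) → R) × (Fin k → R),
          (lam - n * q⁻¹) * steinSol lam A (occurrences g)) / c := by
    rw [← Finset.sum_add_distrib, div_sub' hcpos.ne']
    congr 1
    rw [hc, ← Finset.card_univ, ← nsmul_eq_mul (Finset.card _), ← Finset.sum_const,
      ← Finset.sum_sub_distrib]
    refine Finset.sum_congr rfl fun g _ => ?_
    rw [← hstein]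
    ring
  rw [hsum, abs_div, abs_of_pos hcpos, div_le_iff₀ hcpos]
  refine (abs_add_le _ _).trans ((add_le_add hchen hmass).trans ?_)
  have hnq : 1 / lam * (n * q⁻¹) ≤ 1 := by
    rw [one_div, inv_mul_le_iff₀ hlam, mul_one, ← div_eq_mul_inv, div_le_iff₀ hR]
    exact hn1
  have h1 : 1 / lam * (n * q⁻¹) * (4 * k - 3) ≤ 4 * k - 3 :=
    mul_le_of_le_one_left (by linarith) hnq
  have h2 : 1 / lam * (n * q⁻¹) * (4 * k - 3) + (4 + 5 * lam) ≤ 5 * k * (lam + 1) := by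
    nlinarith
  calc _ = c * q⁻¹ * (1 / lam * (n * q⁻¹) * (4 * k - 3) + (4 + 5 * lam)) := by ring
    _ ≤ c * q⁻¹ * (5 * k * (lam + 1)) := by gcongr
    _ = _ := by ring

end Words

section Law

variable {b k : ℕ} {ν : Measure (ℕ → Fin b)}

/-- Restriction of an infinite sequence to its first `N` letters. -/
def restrictPrefix (N : ℕ) (p : (ℕ → Fin b) × (Fin k → Fin b)) :
    (Fin N → Fin b) × (Fin k → Fin b) :=
  (fun s => p.1 s, p.2)

lemma prod_preimage_restrictPrefix (hν : IsUnifProductMeasure b ν) (N : ℕ)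
    (g : (Fin N → Fin b) × (Fin k → Fin b)) :
    MeasurableSet (restrictPrefix N ⁻¹' {g}) ∧
      ν.prod (muK b k) (restrictPrefix N ⁻¹' {g})
        = ((b : ENNReal)⁻¹) ^ N * ((b : ENNReal) ^ k)⁻¹ := by
  have hset : restrictPrefix N ⁻¹' {g}
      = {x : ℕ → Fin b | ∀ t : Fin N, x (t : ℕ) = g.1 t} ×ˢ {g.2} := by
    ext p
    simp [restrictPrefix, Prod.ext_iff, funext_iff]
  have hcyl : MeasurableSet {x : ℕ → Fin b | ∀ t : Fin N, x (t : ℕ) = g.1 t} := by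
    rw [Set.ofPred_forall]
    exact MeasurableSet.iInter fun t =>
      measurableSet_eq_fun (measurable_pi_apply _) measurable_const
  have : IsProbabilityMeasure ν := ⟨by simpa using hν 0 Fin.elim0⟩
  have : SFinite (muK b k) := by unfold muK; infer_instance
  rw [hset]
  refine ⟨hcyl.prod (measurableSet_singleton _), ?_⟩
  rw [Measure.prod_prod, hν]
  simp [muK]

lemma Mx_eq_occurrences [NeZero b] {n : ℕ} {lam : ℝ} (hlam : 0 < lam)
    (hn : n = ⌊lam * (b : ℝ) ^ k⌋₊) (p : (ℕ → Fin b) × (Fin k → Fin b)) :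
    Mx b k (Set.Ioc 0 lam) p.1 p.2 = occurrences (restrictPrefix (n + k) p) := by
  have hb : (0 : ℝ) < (b : ℝ) ^ k := by
    have : (0 : ℝ) < b := by exact_mod_cast NeZero.pos b
    positivity
  have hset : {j : ℕ | 1 ≤ j ∧ ((j : ℝ) / (b : ℝ) ^ k) ∈ Set.Ioc 0 lam ∧ OccursAt p.1 j p.2}
      = (fun j : Fin n => (j : ℕ) + 1) ''
        {j : Fin n | blockSub j (restrictPrefix (n + k) p) = 0} := by
    ext j
    have hle : (j : ℝ) / (b : ℝ) ^ k ≤ lam ↔ j ≤ n := by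
      rw [div_le_iff₀ hb, hn, Nat.le_floor_iff (by positivity)]
    simp only [Set.mem_ofPred_eq, Set.mem_Ioc, hle, Set.mem_image]
    constructor
    · rintro ⟨h1, ⟨-, h2⟩, h3⟩
      refine ⟨⟨j - 1, by omega⟩, ?_, by simp; omega⟩
      ext1 t
      simpa [blockSub_apply, restrictPrefix, sub_eq_zero] using h3 t
    · rintro ⟨i, hi, rfl⟩
      refine ⟨by omega, ⟨by positivity, by omega⟩, fun t => ?_⟩
      have := congrFun hi t
      simpa [blockSub_apply, restrictPrefix, sub_eq_zero] using this
  rw [Mx, hset, Set.ncard_image_of_injective _ (fun i j h => Fin.ext (by simpa using h)),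
    Set.ncard_eq_toFinset_card', occurrences, Finset.sum_boole]
  simp

lemma lawM_eq_sum_occurrences [NeZero b] (hν : IsUnifProductMeasure b ν) {n : ℕ} {lam : ℝ}
    (hlam : 0 < lam) (hn : n = ⌊lam * (b : ℝ) ^ k⌋₊) (A : Set ℕ) :
    lawM b k ν (Set.Ioc 0 lam) A
      = (∑ g : (Fin (n + k) → Fin b) × (Fin k → Fin b), A.indicator 1 (occurrences g))
        / (Fintype.card ((Fin (n + k) → Fin b) × (Fin k → Fin b)) : ℝ) := by
  classical
  have hset : {p : (ℕ → Fin b) × (Fin k → Fin b) | Mx b k (Set.Ioc 0 lam) p.1 p.2 ∈ A}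
      = restrictPrefix (n + k) ⁻¹'
        ↑(Finset.univ.filter fun g : (Fin (n + k) → Fin b) × (Fin k → Fin b) =>
          occurrences g ∈ A) := by
    ext p
    simp [Mx_eq_occurrences hlam hn]
  rw [lawM, hset, ← sum_measure_preimage_singleton _
    fun g _ => (prod_preimage_restrictPrefix hν _ g).1,
    Finset.sum_congr rfl fun g _ => (prod_preimage_restrictPrefix hν _ g).2]
  simp [Set.indicator_apply, div_eq_mul_inv, mul_comm]

lemma abs_lawM_sub_poissonLaw_le [NeZero b] (hν : IsUnifProductMeasure b ν) {lam : ℝ}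
    (hlam : 0 < lam) (hk : 1 ≤ k) (A : Set ℕ) :
    |lawM b k ν (Set.Ioc 0 lam) A - poissonLaw lam A| ≤ 5 * k * (lam + 1) / (b : ℝ) ^ k := by
  rw [lawM_eq_sum_occurrences hν hlam rfl]
  simpa only [Fintype.card_fin] using
    abs_card_occurrences_sub_poissonLaw_le (R := Fin b) hk hlam (by rw [Fintype.card_fin]) A

end Law

lemma twentyFive_mul_pow_four_lt_two_pow {k : ℕ} (hk : 24 ≤ k) : 25 * k ^ 4 < 2 ^ k := by
  induction k, hk using Nat.le_induction with
  | base => norm_num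
  | succ k hk ih =>
    have h : (k + 1) ^ 4 ≤ 2 * k ^ 4 := by
      obtain ⟨m, rfl⟩ := Nat.exists_eq_add_of_le hk
      ring_nf
      nlinarith [Nat.zero_le (m ^ 2), Nat.zero_le (m ^ 3), Nat.zero_le (m ^ 4)]
    rw [pow_succ 2]
    omega

lemma five_mul_div_pow_lt_one_div {b k : ℕ} (hb : 2 ≤ b) (hk : 24 ≤ k) {lam : ℝ} (hlam : 0 < lam)
    (h : 2 * Real.logb 2 (lam + 1) ≤ k) :
    5 * k * (lam + 1) / (b : ℝ) ^ k < 1 / (k : ℝ) := by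
  have hk0 : (0 : ℝ) < k := by exact_mod_cast (by omega : 0 < k)
  have hb' : (2 : ℝ) ≤ b := by exact_mod_cast hb
  have hsq : (lam + 1) ^ 2 ≤ 2 ^ k := by
    have h1 : Real.logb 2 ((lam + 1) ^ 2) ≤ k := by
      rw [Real.logb_pow]
      exact_mod_cast h
    rw [Real.logb_le_iff_le_rpow (by norm_num) (by positivity)] at h1
    exact_mod_cast h1
  have hpow : 25 * (k : ℝ) ^ 4 < 2 ^ k := by
    exact_mod_cast twentyFive_mul_pow_four_lt_two_pow hk
  have hlt : 5 * (k : ℝ) ^ 2 * (lam + 1) < 2 ^ k := by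
    refine lt_of_pow_lt_pow_left₀ 2 (by positivity) ?_
    calc (5 * (k : ℝ) ^ 2 * (lam + 1)) ^ 2 = 25 * (k : ℝ) ^ 4 * (lam + 1) ^ 2 := by ring
      _ ≤ 25 * (k : ℝ) ^ 4 * 2 ^ k := by gcongr
      _ < 2 ^ k * 2 ^ k := by gcongr
      _ = (2 ^ k) ^ 2 := by ring
  have hbk : (2 : ℝ) ^ k ≤ (b : ℝ) ^ k := by gcongr
  rw [div_lt_div_iff₀ (by positivity) hk0]
  nlinarith

theorem stmt9 (b : ℕ) (hb : 2 ≤ b) (ν : Measure (ℕ → Fin b))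
    (hν : IsUnifProductMeasure b ν) (lam : ℝ) (hlam : 0 < lam) :
    (∀ k : ℕ, 1 ≤ k →
      dTV (lawM b k ν (Set.Ioc 0 lam)) (poissonLaw lam)
        ≤ 5 * k * (lam + 1) / (b : ℝ) ^ k) ∧
    (∀ k : ℕ, 24 ≤ k → 2 * Real.logb 2 (lam + 1) ≤ (k : ℝ) →
      dTV (lawM b k ν (Set.Ioc 0 lam)) (poissonLaw lam) < 1 / (k : ℝ)) := by
  have : NeZero b := ⟨by omega⟩
  have hmain : ∀ k : ℕ, 1 ≤ k → dTV (lawM b k ν (Set.Ioc 0 lam)) (poissonLaw lam)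
      ≤ 5 * k * (lam + 1) / (b : ℝ) ^ k := fun k hk =>
    ciSup_le (abs_lawM_sub_poissonLaw_le hν hlam hk)
  exact ⟨hmain, fun k hk h =>
    (hmain k (by omega)).trans_lt (five_mul_div_pow_lt_one_div hb hk hlam h)⟩
end

section
/- For every real λ > 0, every i ∈ ℕ₀ and every k ≥ max{24, 2·log₂(λ+1)}, one has |(μ^ℕ × μ^k)({(x,ω) : M_k((0,λ])(x,ω) = i}) − e^{−λ} λ^i / i!| < 1/k. -/
open MeasureTheory Filter

open Real Finset

/-- The probability that `n` plus a Poisson variable of mean `t` equals `i`. -/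
noncomputable def shiftedPoisson (i : ℕ) (t : ℝ) (n : ℕ) : ℝ :=
  if n ≤ i then rexp (-t) * t ^ (i - n) / ((i - n).factorial : ℝ) else 0

lemma shiftedPoisson_nonneg (i n : ℕ) {t : ℝ} (ht : 0 ≤ t) : 0 ≤ shiftedPoisson i t n := by
  unfold shiftedPoisson; split_ifs <;> positivity

lemma shiftedPoisson_le_one (i n : ℕ) {t : ℝ} (ht : 0 ≤ t) : shiftedPoisson i t n ≤ 1 := by
  unfold shiftedPoisson
  split_ifs
  · rw [mul_div_assoc]
    calc _ ≤ rexp (-t) * rexp t := by gcongr; exact Real.pow_div_factorial_le_exp t ht _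
      _ = 1 := by rw [← Real.exp_add]; simp
  · exact zero_le_one

/-- The forward difference of `shiftedPoisson` in the shift. -/
noncomputable def shiftedPoissonDiff (i : ℕ) (t : ℝ) (n : ℕ) : ℝ :=
  shiftedPoisson i t (n + 1) - shiftedPoisson i t n

lemma abs_shiftedPoissonDiff_le (i n : ℕ) {t : ℝ} (ht : 0 ≤ t) :
    |shiftedPoissonDiff i t n| ≤ 1 := by
  have h₁ := shiftedPoisson_nonneg i n ht
  have h₂ := shiftedPoisson_nonneg i (n + 1) ht
  have h₃ := shiftedPoisson_le_one i n ht
  have h₄ := shiftedPoisson_le_one i (n + 1) ht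
  rw [shiftedPoissonDiff, abs_le]
  constructor <;> linarith

lemma hasDerivAt_shiftedPoisson (i n : ℕ) (t : ℝ) :
    HasDerivAt (fun s => shiftedPoisson i s n) (shiftedPoissonDiff i t n) t := by
  have hexp : HasDerivAt (fun s : ℝ => rexp (-s)) (-rexp (-t)) t := by
    simpa using (hasDerivAt_neg t).exp
  unfold shiftedPoissonDiff shiftedPoisson
  rcases lt_trichotomy n i with h | h | h
  · obtain ⟨m, rfl⟩ : ∃ m, i = n + (m + 1) := ⟨i - n - 1, by omega⟩
    have h₁ : n + (m + 1) - n = m + 1 := by omega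
    have h₂ : n + (m + 1) - (n + 1) = m := by omega
    have h₃ : n + 1 ≤ n + (m + 1) := by omega
    have h₄ : n ≤ n + (m + 1) := by omega
    simp only [h₁, h₂, h₃, h₄, if_true]
    refine ((hexp.mul (hasDerivAt_pow (m + 1) t)).div_const ((m + 1).factorial : ℝ)).congr_deriv ?_
    rw [Nat.factorial_succ]
    push_cast
    have : (m.factorial : ℝ) ≠ 0 := by positivity
    field_simp
    ring
  · subst h
    simpa using hexp
  · have h₁ : ¬ n ≤ i := by omega
    have h₂ : ¬ n + 1 ≤ i := by omega
    simpa [h₁, h₂] using hasDerivAt_const t (0 : ℝ)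

lemma abs_shiftedPoisson_sub_le (i n : ℕ) {s t : ℝ} (hs : 0 ≤ s) (ht : 0 ≤ t) :
    |shiftedPoisson i t n - shiftedPoisson i s n| ≤ |t - s| := by
  simpa using (convex_Ici (0 : ℝ)).norm_image_sub_le_of_norm_hasDerivWithin_le
    (fun u _ => (hasDerivAt_shiftedPoisson i n u).hasDerivWithinAt)
    (fun u hu => abs_shiftedPoissonDiff_le i n hu) hs ht

lemma abs_shiftedPoisson_add_sub_le (i n : ℕ) {t p : ℝ} (ht : 0 ≤ t) (hp : 0 ≤ p) :
    |shiftedPoisson i (t + p) n - shiftedPoisson i t n - p * shiftedPoissonDiff i t n|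
      ≤ 2 * p ^ 2 := by
  have key := (convex_Icc t (t + p)).norm_image_sub_le_of_norm_hasDerivWithin_le
    (f := fun u => shiftedPoisson i u n - u * shiftedPoissonDiff i t n)
    (f' := fun u => shiftedPoissonDiff i u n - 1 * shiftedPoissonDiff i t n) (C := 2 * p)
    (x := t) (y := t + p)
    (fun u _ => ((hasDerivAt_shiftedPoisson i n u).sub
      ((hasDerivAt_id u).mul_const _)).hasDerivWithinAt)
    (fun u hu => by
      have h₁ := abs_shiftedPoisson_sub_le i n ht (ht.trans hu.1)
      have h₂ := abs_shiftedPoisson_sub_le i (n + 1) ht (ht.trans hu.1)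
      rw [abs_of_nonneg (sub_nonneg.2 hu.1)] at h₁ h₂
      rw [Real.norm_eq_abs]
      simp only [shiftedPoissonDiff]
      have := hu.2
      rw [abs_le] at h₁ h₂ ⊢
      constructor <;> linarith [h₁.1, h₁.2, h₂.1, h₂.2])
    (by simp [hp]) (by simp [hp])
  rw [Real.norm_eq_abs, Real.norm_eq_abs, add_sub_cancel_left, abs_of_nonneg hp] at key
  calc _ = |shiftedPoisson i (t + p) n - (t + p) * shiftedPoissonDiff i t n
      - (shiftedPoisson i t n - t * shiftedPoissonDiff i t n)| := by congr 1; ring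
    _ ≤ 2 * p * p := key
    _ = _ := by ring

lemma shiftedPoisson_zero_time (i n : ℕ) : shiftedPoisson i 0 n = if n = i then 1 else 0 := by
  unfold shiftedPoisson
  rcases lt_trichotomy n i with h | h | h
  · have : i - n ≠ 0 := by omega
    simp [h.ne, this]
  · simp [h]
  · simp [h.ne', h.not_ge]

/-- Extend a finite word by zeros. -/
def extendWord {b n : ℕ} [NeZero b] (v : Fin n → Fin b) : ℕ → Fin b :=
  fun m => if h : m < n then v ⟨m, h⟩ else 0

/-- The average of `F` over all words of length `n`. -/
noncomputable def wordAvg (b n : ℕ) [NeZero b] (F : (ℕ → Fin b) → ℝ) : ℝ :=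
  (∑ v : Fin n → Fin b, F (extendWord v)) / (b : ℝ) ^ n

lemma DependsOn.apply_update {b : ℕ} {β : Type*} {F : (ℕ → Fin b) → β} {n : ℕ}
    (hF : DependsOn F (Set.Iio n)) (x : ℕ → Fin b) (a : Fin b) :
    F (Function.update x n a) = F x :=
  hF fun _ hm => Function.update_of_ne (ne_of_lt hm) _ _

section wordAvg

variable {b : ℕ} [NeZero b]

lemma extendWord_snoc {n : ℕ} (v : Fin n → Fin b) (a : Fin b) :
    extendWord (Fin.snoc v a : Fin (n + 1) → Fin b) = Function.update (extendWord v) n a := by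
  funext m
  rcases lt_trichotomy m n with h | h | h
  · simp [extendWord, Fin.snoc, h, h.ne, h.trans (Nat.lt_succ_self n)]
  · subst h
    simp [extendWord, Fin.snoc]
  · have : ¬ m < n + 1 := by omega
    simp [extendWord, this, h.ne', h.not_gt]

lemma wordAvg_succ (n : ℕ) (F : (ℕ → Fin b) → ℝ) :
    wordAvg b (n + 1) F
      = wordAvg b n (fun x => (∑ a, F (Function.update x n a)) / b) := by
  unfold wordAvg
  rw [← (Fin.snocEquiv (fun _ : Fin (n + 1) => Fin b)).sum_comp, Fintype.sum_prod_type_right,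
    ← Finset.sum_div, div_div, pow_succ']
  congr 1
  refine Finset.sum_congr rfl fun v _ => Finset.sum_congr rfl fun a _ => ?_
  exact congrArg F (extendWord_snoc v a)

lemma wordAvg_add (n : ℕ) (F G : (ℕ → Fin b) → ℝ) :
    wordAvg b n (fun x => F x + G x) = wordAvg b n F + wordAvg b n G := by
  simp [wordAvg, Finset.sum_add_distrib, add_div]

lemma wordAvg_sub (n : ℕ) (F G : (ℕ → Fin b) → ℝ) :
    wordAvg b n (fun x => F x - G x) = wordAvg b n F - wordAvg b n G := by
  simp [wordAvg, Finset.sum_sub_distrib, sub_div]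

lemma wordAvg_const_mul (n : ℕ) (c : ℝ) (F : (ℕ → Fin b) → ℝ) :
    wordAvg b n (fun x => c * F x) = c * wordAvg b n F := by
  simp [wordAvg, ← Finset.mul_sum, mul_div_assoc]

lemma wordAvg_sum {ι : Type*} (n : ℕ) (s : Finset ι) (F : ι → (ℕ → Fin b) → ℝ) :
    wordAvg b n (fun x => ∑ r ∈ s, F r x) = ∑ r ∈ s, wordAvg b n (F r) := by
  simp only [wordAvg]
  rw [Finset.sum_comm, Finset.sum_div]

lemma wordAvg_const (n : ℕ) (c : ℝ) : wordAvg b n (fun _ => c) = c := by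
  have : (b : ℝ) ≠ 0 := NeZero.ne _
  simp [wordAvg]
  field_simp

lemma wordAvg_mono (n : ℕ) {F G : (ℕ → Fin b) → ℝ} (h : ∀ x, F x ≤ G x) :
    wordAvg b n F ≤ wordAvg b n G := by
  unfold wordAvg
  gcongr
  exact h _

lemma abs_wordAvg_le (n : ℕ) (F : (ℕ → Fin b) → ℝ) :
    |wordAvg b n F| ≤ wordAvg b n (fun x => |F x|) := by
  unfold wordAvg
  rw [abs_div, abs_of_nonneg (by positivity : (0 : ℝ) ≤ (b : ℝ) ^ n)]
  gcongr
  exact Finset.abs_sum_le_sum_abs _ _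

lemma wordAvg_eq_of_dependsOn {n m : ℕ} (hnm : n ≤ m) {F : (ℕ → Fin b) → ℝ}
    (hF : DependsOn F (Set.Iio n)) : wordAvg b m F = wordAvg b n F := by
  induction m, hnm using Nat.le_induction with
  | base => rfl
  | succ m hm ih =>
    have hF' : DependsOn F (Set.Iio m) := fun x y h => hF fun r hr => h r (lt_of_lt_of_le hr hm)
    have hb : (b : ℝ) ≠ 0 := NeZero.ne _
    rw [wordAvg_succ, ← ih]
    congr 1
    funext x
    simp [hF'.apply_update, hb]

lemma wordAvg_mul_indicator_eq {n : ℕ} {F : (ℕ → Fin b) → ℝ} {c : (ℕ → Fin b) → Fin b}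
    (hF : DependsOn F (Set.Iio n)) (hc : DependsOn c (Set.Iio n)) :
    wordAvg b (n + 1) (fun x => F x * if x n = c x then 1 else 0) = wordAvg b n F / b := by
  rw [wordAvg_succ]
  simp only [hF.apply_update, hc.apply_update, Function.update_self]
  simp [wordAvg, Finset.sum_div, div_right_comm]

/-- Forcing `m` consecutive letters, each to a value determined by the preceding letters,
costs a factor `b ^ m`. -/
lemma wordAvg_mul_indicator_forall {s : ℕ} {F : (ℕ → Fin b) → ℝ}
    (hF : DependsOn F (Set.Iio s)) {c : ℕ → (ℕ → Fin b) → Fin b}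
    (m : ℕ) (hc : ∀ t < m, DependsOn (c t) (Set.Iio (s + t))) :
    wordAvg b (s + m) (fun x => F x * if ∀ t < m, x (s + t) = c t x then 1 else 0)
      = wordAvg b s F / (b : ℝ) ^ m := by
  induction m with
  | zero => simp
  | succ m ih =>
    have hdep : DependsOn (fun x : ℕ → Fin b =>
        F x * if ∀ t < m, x (s + t) = c t x then (1 : ℝ) else 0) (Set.Iio (s + m)) := by
      intro x y h
      have h₁ : F x = F y := hF fun r hr => h r (lt_of_lt_of_le hr (Nat.le_add_right s m))
      have h₂ : (∀ t < m, x (s + t) = c t x) ↔ (∀ t < m, y (s + t) = c t y) := by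
        refine forall₂_congr fun t ht => ?_
        rw [h (s + t) (by simp; omega),
          hc t (by omega) fun r hr => h r (by simp at hr ⊢; omega)]
      simp only [h₁, h₂]
    have := wordAvg_mul_indicator_eq hdep (hc m (Nat.lt_succ_self m))
    rw [ih fun t ht => hc t (ht.trans (Nat.lt_succ_self m)), div_div, ← pow_succ] at this
    rw [← add_assoc, ← this]
    congr 1
    funext x
    rw [mul_assoc]
    congr 1
    simp only [Nat.lt_succ_iff_lt_or_eq, or_imp, forall_and, forall_eq, ite_and, mul_ite, mul_one,
      mul_zero]
    split_ifs <;> rfl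

end wordAvg

section occurrences

variable {b k : ℕ}

/-- The indicator that `w` occurs in `x` with exactly `r` letters before it. -/
noncomputable def occInd (w : Fin k → Fin b) (r : ℕ) (x : ℕ → Fin b) : ℝ :=
  if OccursAt x (r + 1) w then 1 else 0

/-- The number of occurrences of `w` in `x` starting at one of the first `s` letters. -/
def occCount (w : Fin k → Fin b) (s : ℕ) (x : ℕ → Fin b) : ℕ :=
  #{r ∈ range s | OccursAt x (r + 1) w}

lemma occInd_nonneg (w : Fin k → Fin b) (r : ℕ) (x : ℕ → Fin b) : 0 ≤ occInd w r x := by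
  unfold occInd; split_ifs <;> norm_num

lemma occursAt_congr (w : Fin k → Fin b) {r m : ℕ} (hr : r + k ≤ m) {x y : ℕ → Fin b}
    (h : ∀ j ∈ Set.Iio m, x j = y j) : OccursAt x (r + 1) w ↔ OccursAt y (r + 1) w := by
  refine forall_congr' fun t => ?_
  rw [h _ (by have := t.2; simp only [Set.mem_Iio]; omega)]

lemma dependsOn_occInd (w : Fin k → Fin b) {r m : ℕ} (hr : r + k ≤ m) :
    DependsOn (occInd w r) (Set.Iio m) := fun _ _ h => by
  simp only [occInd, occursAt_congr w hr h]

lemma dependsOn_occCount (w : Fin k → Fin b) {s m : ℕ} (hs : ∀ r < s, r + k ≤ m) :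
    DependsOn (occCount w s) (Set.Iio m) := fun _ _ h => by
  unfold occCount
  congr 1
  exact Finset.filter_congr fun r hr => occursAt_congr w (hs r (Finset.mem_range.1 hr)) h

lemma occCount_eq_sum (w : Fin k → Fin b) (s : ℕ) (x : ℕ → Fin b) :
    (occCount w s x : ℝ) = ∑ r ∈ range s, occInd w r x := by
  simp [occCount, occInd]

lemma occCount_succ (w : Fin k → Fin b) (s : ℕ) (x : ℕ → Fin b) :
    occCount w (s + 1) x = occCount w s x + if OccursAt x (s + 1) w then 1 else 0 := by
  unfold occCount
  rw [Finset.range_add_one, Finset.filter_insert]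
  split_ifs <;> simp

lemma occCount_eq_or_one_le_sum (w : Fin k → Fin b) {s' s : ℕ} (h : s' ≤ s) (x : ℕ → Fin b) :
    occCount w s x = occCount w s' x ∨ 1 ≤ ∑ r ∈ Ico s' s, occInd w r x := by
  have hsum := Finset.sum_range_add_sum_Ico (fun r => occInd w r x) h
  rw [← occCount_eq_sum, ← occCount_eq_sum] at hsum
  by_cases heq : occCount w s x = occCount w s' x
  · exact Or.inl heq
  · right
    have hle : occCount w s' x ≤ occCount w s x :=
      Finset.card_le_card (Finset.filter_subset_filter _ (Finset.range_subset_range.2 h))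
    have hlt : (occCount w s' x : ℝ) + 1 ≤ occCount w s x := by
      exact_mod_cast lt_of_le_of_ne hle (Ne.symm heq)
    linarith

variable [NeZero b]

lemma wordAvg_mul_occInd (w : Fin k → Fin b) {s n : ℕ} (hn : s + k ≤ n)
    {F : (ℕ → Fin b) → ℝ} (hF : DependsOn F (Set.Iio s)) :
    wordAvg b n (fun x => F x * occInd w s x) = wordAvg b n F / (b : ℝ) ^ k := by
  have hdep : DependsOn (fun x => F x * occInd w s x) (Set.Iio (s + k)) := fun x y h => by
    simp only [dependsOn_occInd w le_rfl h,
      hF fun r hr => h r (lt_of_lt_of_le hr (Nat.le_add_right s k))]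
  rw [wordAvg_eq_of_dependsOn hn hdep, wordAvg_eq_of_dependsOn (by omega : s ≤ n) hF,
    ← wordAvg_mul_indicator_forall hF (c := fun t _ => if h : t < k then w ⟨t, h⟩ else 0) k
      fun t _ x y _ => rfl]
  congr 1
  funext x
  congr 1
  unfold occInd
  congr 1
  refine propext ⟨fun h t ht => ?_, fun h t => ?_⟩
  · simpa [ht] using h ⟨t, ht⟩
  · simpa using h t t.2

lemma wordAvg_occInd (w : Fin k → Fin b) {s n : ℕ} (hn : s + k ≤ n) :
    wordAvg b n (occInd w s) = 1 / (b : ℝ) ^ k := by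
  have := wordAvg_mul_occInd w hn (F := fun _ => 1) fun _ _ _ => rfl
  simpa [wordAvg_const] using this

/-- For a uniformly random word, occurrences at two distinct positions are uncorrelated,
even if the positions overlap. -/
lemma sum_wordAvg_occInd_mul_occInd {r s n : ℕ} (hrs : r < s) (hn : s + k ≤ n) :
    ∑ w : Fin k → Fin b, wordAvg b n (fun x => occInd w r x * occInd w s x)
      = 1 / (b : ℝ) ^ k := by
  have hpoint : ∀ x : ℕ → Fin b, ∑ w : Fin k → Fin b, occInd w r x * occInd w s x
      = 1 * if ∀ t < k, x (s + t) = x (r + t) then 1 else 0 := fun x => by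
    have h₁ : ∀ w : Fin k → Fin b, OccursAt x (r + 1) w ↔ (fun t : Fin k => x (r + t)) = w :=
      fun w => by simp [OccursAt, funext_iff]
    simp only [occInd, h₁, ite_mul, one_mul, zero_mul, Finset.sum_ite_eq, Finset.mem_univ,
      if_true]
    congr 1
    refine propext ⟨fun h t ht => ?_, fun h t => ?_⟩
    · simpa using h ⟨t, ht⟩
    · simpa using h t t.2
  rw [← wordAvg_sum, funext hpoint, wordAvg_eq_of_dependsOn hn,
    wordAvg_mul_indicator_forall (fun _ _ _ => rfl) (c := fun t x => x (r + t)) k, wordAvg_const]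
  · exact fun t _ x y h => h _ (by simp only [Set.mem_Iio]; omega)
  · intro x y h
    simp only
    congr 1
    refine if_congr (forall₂_congr fun t ht => ?_) rfl rfl
    rw [h (s + t) (by simp only [Set.mem_Iio]; omega), h (r + t) (by simp only [Set.mem_Iio]; omega)]

/-- Average over all words of length `k` and all sequences truncated at length `n`. -/
noncomputable def jointAvg (b k n : ℕ) [NeZero b] (F : (Fin k → Fin b) → (ℕ → Fin b) → ℝ) : ℝ :=
  (∑ w : Fin k → Fin b, wordAvg b n (F w)) / (b : ℝ) ^ k

lemma jointAvg_add (n : ℕ) (F G : (Fin k → Fin b) → (ℕ → Fin b) → ℝ) :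
    jointAvg b k n (fun w x => F w x + G w x) = jointAvg b k n F + jointAvg b k n G := by
  simp [jointAvg, wordAvg_add, Finset.sum_add_distrib, add_div]

lemma jointAvg_sub (n : ℕ) (F G : (Fin k → Fin b) → (ℕ → Fin b) → ℝ) :
    jointAvg b k n (fun w x => F w x - G w x) = jointAvg b k n F - jointAvg b k n G := by
  simp [jointAvg, wordAvg_sub, Finset.sum_sub_distrib, sub_div]

lemma jointAvg_const_mul (n : ℕ) (c : ℝ) (F : (Fin k → Fin b) → (ℕ → Fin b) → ℝ) :
    jointAvg b k n (fun w x => c * F w x) = c * jointAvg b k n F := by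
  simp [jointAvg, wordAvg_const_mul, ← Finset.mul_sum, mul_div_assoc]

lemma jointAvg_sum {ι : Type*} (n : ℕ) (s : Finset ι)
    (F : ι → (Fin k → Fin b) → (ℕ → Fin b) → ℝ) :
    jointAvg b k n (fun w x => ∑ r ∈ s, F r w x) = ∑ r ∈ s, jointAvg b k n (F r) := by
  simp only [jointAvg, wordAvg_sum]
  rw [Finset.sum_comm, Finset.sum_div]

lemma jointAvg_const (n : ℕ) (c : ℝ) : jointAvg b k n (fun _ _ => c) = c := by
  have : (b : ℝ) ≠ 0 := NeZero.ne _
  simp only [jointAvg, wordAvg_const]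
  simp
  field_simp

lemma abs_jointAvg_le (n : ℕ) {F G : (Fin k → Fin b) → (ℕ → Fin b) → ℝ}
    (h : ∀ w x, |F w x| ≤ G w x) : |jointAvg b k n F| ≤ jointAvg b k n G := by
  unfold jointAvg
  rw [abs_div, abs_of_nonneg (by positivity : (0 : ℝ) ≤ (b : ℝ) ^ k)]
  gcongr
  exact (Finset.abs_sum_le_sum_abs _ _).trans
    (Finset.sum_le_sum fun w _ => (abs_wordAvg_le n _).trans (wordAvg_mono n (h w)))

lemma jointAvg_occInd {s n : ℕ} (hn : s + k ≤ n) :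
    jointAvg b k n (fun w x => occInd w s x) = 1 / (b : ℝ) ^ k := by
  rw [← jointAvg_const (b := b) (k := k) n (1 / (b : ℝ) ^ k)]
  simp only [jointAvg, wordAvg_const]
  congr 1
  exact Finset.sum_congr rfl fun w _ => wordAvg_occInd w hn

lemma jointAvg_occInd_mul_occInd {r s n : ℕ} (hrs : r < s) (hn : s + k ≤ n) :
    jointAvg b k n (fun w x => occInd w r x * occInd w s x) = (1 / (b : ℝ) ^ k) ^ 2 := by
  rw [jointAvg, sum_wordAvg_occInd_mul_occInd hrs hn]
  ring

/-- One replacement step: trading the occurrence indicator at one position for a Poisson variable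
of mean `1 / b ^ k`. -/
lemma abs_jointAvg_shiftedPoisson_step_le (i : ℕ) (hk : 1 ≤ k) {s n : ℕ} (hn : s + k ≤ n)
    {t p : ℝ} (ht : 0 ≤ t) (hp : p = 1 / (b : ℝ) ^ k) :
    |jointAvg b k n (fun w x => shiftedPoisson i t (occCount w (s + 1) x))
      - jointAvg b k n (fun w x => shiftedPoisson i (t + p) (occCount w s x))|
      ≤ (4 * k - 2) * p ^ 2 := by
  have hp₀ : 0 ≤ p := by rw [hp]; positivity
  set s' := s + 1 - k with hs'
  have hzero : jointAvg b k n (fun w x =>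
      shiftedPoissonDiff i t (occCount w s' x) * occInd w s x
        - p * shiftedPoissonDiff i t (occCount w s' x)) = 0 := by
    rw [jointAvg_sub, jointAvg_const_mul, sub_eq_zero]
    simp only [jointAvg]
    rw [← mul_div_assoc, Finset.mul_sum]
    congr 1
    refine Finset.sum_congr rfl fun w _ => ?_
    rw [wordAvg_mul_occInd w hn, hp]
    · ring
    · exact fun x y h => congrArg (shiftedPoissonDiff i t)
        (dependsOn_occCount w (by omega) h)
  rw [← jointAvg_sub, ← sub_zero (jointAvg b k n _), ← hzero, ← jointAvg_sub]
  have hbound : jointAvg b k n (fun w x =>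
      2 * ∑ r ∈ Ico s' s, (occInd w r x * occInd w s x + p * occInd w r x) + 2 * p ^ 2)
      ≤ (4 * k - 2) * p ^ 2 := by
    rw [jointAvg_add, jointAvg_const_mul, jointAvg_sum, jointAvg_const]
    have hterm : ∀ r ∈ Ico s' s, jointAvg b k n
        (fun w x => occInd w r x * occInd w s x + p * occInd w r x) = 2 * p ^ 2 := fun r hr => by
      have hrs := (Finset.mem_Ico.1 hr).2
      rw [jointAvg_add, jointAvg_const_mul, jointAvg_occInd_mul_occInd hrs hn,
        jointAvg_occInd (by omega), ← hp]
      ring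
    rw [Finset.sum_congr rfl hterm, Finset.sum_const, Nat.card_Ico, nsmul_eq_mul]
    have hcard : ((s - s' : ℕ) : ℝ) ≤ k - 1 := by
      have : s - s' + 1 ≤ k := by omega
      have : ((s - s' : ℕ) : ℝ) + 1 ≤ k := by exact_mod_cast this
      linarith
    nlinarith [mul_le_mul_of_nonneg_right hcard (sq_nonneg p)]
  refine (abs_jointAvg_le n fun w x => ?_).trans hbound
  have htaylor := abs_shiftedPoisson_add_sub_le i (occCount w s x) ht hp₀
  have hocc := occInd_nonneg w s x
  have hstep : shiftedPoisson i t (occCount w (s + 1) x)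
      = shiftedPoisson i t (occCount w s x)
        + shiftedPoissonDiff i t (occCount w s x) * occInd w s x := by
    rw [occCount_succ, occInd, shiftedPoissonDiff]
    split_ifs <;> simp
  have hdiff : |shiftedPoissonDiff i t (occCount w s x) - shiftedPoissonDiff i t (occCount w s' x)|
      ≤ 2 * ∑ r ∈ Ico s' s, occInd w r x := by
    rcases occCount_eq_or_one_le_sum w (by omega : s' ≤ s) x with h | h
    · rw [h, sub_self, abs_zero]
      exact mul_nonneg zero_le_two (Finset.sum_nonneg fun r _ => occInd_nonneg w r x)
    · have h₁ := abs_shiftedPoissonDiff_le i (occCount w s x) ht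
      have h₂ := abs_shiftedPoissonDiff_le i (occCount w s' x) ht
      exact (abs_sub _ _).trans (by linarith)
  rw [hstep, Finset.sum_add_distrib, ← Finset.sum_mul, ← Finset.mul_sum]
  set d := shiftedPoissonDiff i t (occCount w s x)
  set d' := shiftedPoissonDiff i t (occCount w s' x)
  set J := occInd w s x
  set S := ∑ r ∈ Ico s' s, occInd w r x
  have hprod : |(d - d') * (J - p)| ≤ 2 * S * (J + p) := by
    rw [abs_mul]
    refine mul_le_mul hdiff (abs_le.2 ?_) (abs_nonneg _) ((abs_nonneg _).trans hdiff)
    constructor <;> linarith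
  calc _ = |(d - d') * (J - p) - (shiftedPoisson i (t + p) (occCount w s x)
        - shiftedPoisson i t (occCount w s x) - p * d)| := by congr 1; ring
    _ ≤ _ := (abs_sub _ _).trans (by linarith)

/-- Poisson approximation, in the finite model, of the number of occurrences of a random word. -/
lemma abs_jointAvg_occCount_sub_le (i : ℕ) (hk : 1 ≤ k) {N n : ℕ} (hn : N + k ≤ n)
    {lam p : ℝ} (hp : p = 1 / (b : ℝ) ^ k) (hN : N * p ≤ lam) :
    |jointAvg b k n (fun w x => if occCount w N x = i then 1 else 0)
      - rexp (-lam) * lam ^ i / (i.factorial : ℝ)|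
      ≤ (lam - N * p) + N * ((4 * k - 2) * p ^ 2) := by
  have hp₀ : 0 ≤ p := by rw [hp]; positivity
  have htele : ∀ s ≤ N,
      |jointAvg b k n (fun w x => shiftedPoisson i (lam - s * p) (occCount w s x))
        - rexp (-lam) * lam ^ i / (i.factorial : ℝ)| ≤ s * ((4 * k - 2) * p ^ 2) := by
    intro s
    induction s with
    | zero => intro _; simp [occCount, shiftedPoisson, jointAvg_const]
    | succ s ih =>
      intro hs
      have hsN : ((s + 1 : ℕ) : ℝ) * p ≤ N * p := by gcongr
      have hstep := abs_jointAvg_shiftedPoisson_step_le i hk (s := s) (n := n) (by omega)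
        (sub_nonneg.2 (hsN.trans hN)) hp
      have htime : lam - ((s + 1 : ℕ) : ℝ) * p + p = lam - s * p := by push_cast; ring
      rw [htime] at hstep
      refine (abs_sub_le _ _ _).trans ((add_le_add hstep (ih (by omega))).trans_eq ?_)
      push_cast
      ring
  refine (abs_sub_le _ (jointAvg b k n
    fun w x => shiftedPoisson i (lam - N * p) (occCount w N x)) _).trans
    (add_le_add ?_ (htele N le_rfl))
  rw [← jointAvg_sub]
  refine (abs_jointAvg_le n fun w x => ?_).trans_eq (jointAvg_const n _)
  rw [← shiftedPoisson_zero_time]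
  refine (abs_shiftedPoisson_sub_le i _ (sub_nonneg.2 hN) le_rfl).trans_eq ?_
  rw [zero_sub, abs_neg, abs_of_nonneg (sub_nonneg.2 hN)]

end occurrences

section measure

variable {b : ℕ} {ν : Measure (ℕ → Fin b)}

lemma measurableSet_cylinder_word {n : ℕ} (v : Fin n → Fin b) :
    MeasurableSet {x : ℕ → Fin b | ∀ t : Fin n, x (t : ℕ) = v t} := by
  simp only [Set.ofPred_forall]
  exact MeasurableSet.iInter fun t =>
    measurableSet_eq_fun (measurable_pi_apply (t : ℕ)) measurable_const

lemma extendWord_apply [NeZero b] {n : ℕ} (v : Fin n → Fin b) (t : Fin n) :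
    extendWord v t = v t := by
  simp [extendWord]

open Classical in
lemma eq_biUnion_cylinder [NeZero b] {n : ℕ} {S : Set (ℕ → Fin b)}
    (hS : DependsOn (fun x => x ∈ S) (Set.Iio n)) :
    S = ⋃ v ∈ ({v | extendWord v ∈ S} : Finset (Fin n → Fin b)),
      {x | ∀ t : Fin n, x (t : ℕ) = v t} := by
  ext x
  have hext : ∀ v : Fin n → Fin b, (∀ t : Fin n, x (t : ℕ) = v t) →
      (x ∈ S) = (extendWord v ∈ S) := fun v hv => hS fun j hj => by
    rw [hv ⟨j, hj⟩, ← extendWord_apply v ⟨j, hj⟩]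
  simp only [Finset.mem_filter, Finset.mem_univ, true_and, Set.mem_iUnion, Set.mem_ofPred_eq,
    exists_prop]
  constructor
  · exact fun hx => ⟨fun t => x t, by rwa [← hext _ fun _ => rfl], fun _ => rfl⟩
  · rintro ⟨v, hv, hxv⟩
    rwa [hext v hxv]

lemma measurableSet_of_dependsOn [NeZero b] {n : ℕ} {S : Set (ℕ → Fin b)}
    (hS : DependsOn (fun x => x ∈ S) (Set.Iio n)) : MeasurableSet S := by
  rw [eq_biUnion_cylinder hS]
  exact Finset.measurableSet_biUnion _ fun v _ => measurableSet_cylinder_word v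

open Classical in
lemma IsUnifProductMeasure.measureReal_eq_wordAvg [NeZero b] (hν : IsUnifProductMeasure b ν)
    {n : ℕ} {S : Set (ℕ → Fin b)} (hS : DependsOn (fun x => x ∈ S) (Set.Iio n)) :
    (ν S).toReal = wordAvg b n (fun x => if x ∈ S then 1 else 0) := by
  conv_lhs => rw [eq_biUnion_cylinder hS]
  rw [measure_biUnion_finset]
  · simp_rw [hν n]
    simp [wordAvg, div_eq_mul_inv]
  · intro v _ v' _ hvv
    refine Set.disjoint_left.2 fun x hx hx' => hvv (funext fun t => ?_)
    rw [← hx t, hx' t]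
  · exact fun v _ => measurableSet_cylinder_word v

lemma IsUnifProductMeasure.isProbabilityMeasure (hν : IsUnifProductMeasure b ν) :
    IsProbabilityMeasure ν :=
  ⟨by simpa using hν 0 Fin.elim0⟩

lemma muK_singleton (k : ℕ) (w : Fin k → Fin b) : muK b k {w} = ((b : ENNReal) ^ k)⁻¹ := by
  simp [muK]

lemma isFiniteMeasure_muK [NeZero b] (k : ℕ) : IsFiniteMeasure (muK b k) := by
  refine ⟨?_⟩
  rw [muK, Measure.smul_apply, smul_eq_mul]
  refine ENNReal.mul_lt_top (ENNReal.inv_lt_top.2 ?_) (measure_lt_top _ _)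
  have : (b : ENNReal) ≠ 0 := NeZero.ne _
  positivity

lemma prod_muK_toReal [NeZero b] [IsFiniteMeasure ν] {k : ℕ}
    {T : Set ((ℕ → Fin b) × (Fin k → Fin b))}
    (hT : ∀ w, MeasurableSet {x | (x, w) ∈ T}) :
    ((ν.prod (muK b k)) T).toReal
      = (∑ w : Fin k → Fin b, (ν {x | (x, w) ∈ T}).toReal) / (b : ℝ) ^ k := by
  have := isFiniteMeasure_muK (b := b) k
  have hunion : T = ⋃ w ∈ (Finset.univ : Finset (Fin k → Fin b)), {x | (x, w) ∈ T} ×ˢ {w} := by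
    ext ⟨x, w⟩
    simp
  conv_lhs => rw [hunion]
  rw [measure_biUnion_finset]
  · simp only [Measure.prod_prod, muK_singleton]
    rw [ENNReal.toReal_sum, Finset.sum_div]
    · simp [div_eq_mul_inv]
    · intro w _
      rw [← muK_singleton k w]
      exact ENNReal.mul_ne_top (measure_ne_top _ _) (measure_ne_top _ _)
  · intro w _ w' _ hww
    refine Set.disjoint_left.2 fun z hz hz' => hww ?_
    exact (Set.mem_singleton_iff.1 hz.2).symm.trans hz'.2
  · exact fun w _ => (hT w).prod (measurableSet_singleton w)

lemma Mx_Ioc_eq_occCount {k : ℕ} (hb : 0 < b) {lam : ℝ} (hlam : 0 ≤ lam) (x : ℕ → Fin b)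
    (w : Fin k → Fin b) :
    Mx b k (Set.Ioc 0 lam) x w = occCount w ⌊lam * (b : ℝ) ^ k⌋₊ x := by
  have hB : (0 : ℝ) < (b : ℝ) ^ k := by positivity
  have himage : {j : ℕ | 1 ≤ j ∧ ((j : ℝ) / (b : ℝ) ^ k) ∈ Set.Ioc 0 lam ∧ OccursAt x j w}
      = (fun r => r + 1) ''
        (({r ∈ range ⌊lam * (b : ℝ) ^ k⌋₊ | OccursAt x (r + 1) w} : Finset ℕ) : Set ℕ) := by
    ext j
    simp only [Set.mem_ofPred_eq, Set.mem_Ioc, Set.mem_image, Finset.coe_filter, Finset.mem_range,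
      div_le_iff₀ hB]
    constructor
    · rintro ⟨h₁, ⟨-, h₂⟩, h₃⟩
      have := Nat.le_floor h₂
      exact ⟨j - 1, ⟨by omega, by rwa [Nat.sub_add_cancel h₁]⟩, Nat.sub_add_cancel h₁⟩
    · rintro ⟨r, ⟨h₁, h₂⟩, rfl⟩
      refine ⟨by omega, ⟨by positivity, ?_⟩, h₂⟩
      exact (Nat.le_floor_iff (by positivity)).1 h₁
  rw [Mx, himage, Set.ncard_image_of_injective _ (add_left_injective 1), Set.ncard_coe_finset,
    occCount]

end measure

lemma sixteen_mul_pow_four_lt_two_pow {k : ℕ} (hk : 24 ≤ k) : 16 * k ^ 4 < 2 ^ k := by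
  induction k, hk using Nat.le_induction with
  | base => norm_num
  | succ k hk ih =>
    have h₁ : (k + 1) ^ 4 ≤ 2 * k ^ 4 := by
      have h₂ : 24 * k ^ 3 ≤ k ^ 4 := by
        rw [pow_succ k 3, mul_comm]; exact Nat.mul_le_mul_left _ hk
      nlinarith [Nat.pow_le_pow_left (by omega : 1 ≤ k) 3, Nat.mul_le_mul hk hk,
        Nat.mul_le_mul_left (k ^ 2) (by omega : 1 ≤ k)]
    rw [pow_succ 2 k]
    omega

theorem stmt10 (b : ℕ) (hb : 2 ≤ b) (ν : Measure (ℕ → Fin b))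
    (hν : IsUnifProductMeasure b ν) (lam : ℝ) (hlam : 0 < lam) (i : ℕ) (k : ℕ)
    (hk24 : 24 ≤ k) (hklog : 2 * Real.logb 2 (lam + 1) ≤ (k : ℝ)) :
    |((ν.prod (muK b k))
        {pr : (ℕ → Fin b) × (Fin k → Fin b) | Mx b k (Set.Ioc 0 lam) pr.1 pr.2 = i}).toReal
      - Real.exp (-lam) * lam ^ i / (Nat.factorial i : ℝ)| < 1 / (k : ℝ) := by
  have hb₀ : 0 < b := by omega
  have : NeZero b := ⟨hb₀.ne'⟩
  have := hν.isProbabilityMeasure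
  set N := ⌊lam * (b : ℝ) ^ k⌋₊ with hN
  set B : ℝ := (b : ℝ) ^ k with hB
  have hB₀ : 0 < B := by positivity
  have hdep : ∀ w : Fin k → Fin b,
      DependsOn (fun x => x ∈ {x : ℕ → Fin b | occCount w N x = i}) (Set.Iio (N + k)) :=
    fun w x y h => by
      simp only [Set.mem_ofPred_eq, dependsOn_occCount w (s := N) (m := N + k) (by omega) h]
  have hprob : ((ν.prod (muK b k))
      {pr : (ℕ → Fin b) × (Fin k → Fin b) | Mx b k (Set.Ioc 0 lam) pr.1 pr.2 = i}).toReal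
      = jointAvg b k (N + k) (fun w x => if occCount w N x = i then 1 else 0) := by
    simp only [Mx_Ioc_eq_occCount hb₀ hlam.le]
    rw [prod_muK_toReal fun w => measurableSet_of_dependsOn (hdep w), jointAvg]
    congr 1
    refine Finset.sum_congr rfl fun w _ => ?_
    refine (hν.measureReal_eq_wordAvg (hdep w)).trans ?_
    simp only [Set.mem_ofPred_eq]
    congr!
  have hfloor : (N : ℝ) ≤ lam * B := Nat.floor_le (by positivity)
  have hfloor' : lam * B < N + 1 := Nat.lt_floor_add_one _
  have hNp : (N : ℝ) * (1 / B) ≤ lam := by rwa [mul_one_div, div_le_iff₀ hB₀]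
  have hNp' : lam - (N : ℝ) * (1 / B) ≤ 1 / B := by
    rw [mul_one_div, sub_le_iff_le_add, ← add_div, le_div_iff₀ hB₀]
    linarith
  rw [hprob]
  refine (abs_jointAvg_occCount_sub_le i (by omega) le_rfl rfl hNp).trans_lt ?_
  have hk : (24 : ℝ) ≤ k := by exact_mod_cast hk24
  have hsq : (lam + 1) ^ 2 ≤ B := by
    have h₁ : Real.logb 2 ((lam + 1) ^ 2) ≤ k := by
      rw [Real.logb_pow]; exact_mod_cast hklog
    rw [Real.logb_le_iff_le_rpow one_lt_two (by positivity), Real.rpow_natCast] at h₁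
    refine h₁.trans ?_
    rw [hB]
    gcongr
    exact_mod_cast hb
  have hpow : (4 * (k : ℝ) ^ 2) ^ 2 < B := by
    have h₁ : (16 * (k : ℝ) ^ 4) < 2 ^ k := by
      exact_mod_cast sixteen_mul_pow_four_lt_two_pow hk24
    have h₂ : (2 : ℝ) ^ k ≤ B := by
      rw [hB]
      gcongr
      exact_mod_cast hb
    linarith
  have hmul : 4 * (k : ℝ) ^ 2 * (lam + 1) < B := by
    refine lt_of_pow_lt_pow_left₀ 2 hB₀.le ?_
    rw [mul_pow, sq B]
    exact mul_lt_mul hpow hsq (by positivity) hB₀.le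
  have hmain : (N : ℝ) * ((4 * k - 2) * (1 / B) ^ 2) ≤ lam * ((4 * k - 2) * (1 / B)) := by
    have h₁ : (0 : ℝ) ≤ (4 * k - 2) * (1 / B) := mul_nonneg (by linarith) (by positivity)
    calc _ = (N : ℝ) * (1 / B) * ((4 * k - 2) * (1 / B)) := by ring
      _ ≤ _ := by gcongr
  calc _ ≤ 1 / B + lam * ((4 * k - 2) * (1 / B)) := add_le_add hNp' hmain
    _ = (1 + lam * (4 * k - 2)) / B := by ring
    _ < 1 / k := by
      rw [div_lt_div_iff₀ hB₀ (by linarith)]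
      nlinarith [mul_pos hlam (by linarith : (0 : ℝ) < k)]
end
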